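/- arXiv:1403.2117 — 2 statements merged into one kernel-verified Lean document; each statement's English description precedes it below -/
import Mathlib

section
/- Let dim V = 4 and let R be an algebraic curvature operator on Λ²V such that sec_R(σ) ≥ 0 for every decomposable σ ∈ Λ²V and sec_R(σ₀) = 0 for some nonzero decomposable σ₀ ∈ Λ²V. Then there exists a unique ω ∈ Λ⁴V such that R + ω is positive-semidefinite. -/
/- Common setup: an abstract model of the second and fourth exterior powers
`Λ²V` and `Λ⁴V` of a real inner product space `V`, with the induced inner
products, the identification of 4-vectors with self-adjoint operators on
`Λ²V`, and the Bianchi map. -/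

noncomputable section

open scoped InnerProductSpace

/-- A linear operator on a real inner product space is positive-semidefinite. -/
def IsPosSemidef {E : Type*} [NormedAddCommGroup E] [InnerProductSpace ℝ E]
    (T : E →ₗ[ℝ] E) : Prop :=
  ∀ v : E, 0 ≤ ⟪T v, v⟫_ℝ

/-- A linear operator on a real inner product space is positive-definite. -/
def IsPosDef {E : Type*} [NormedAddCommGroup E] [InnerProductSpace ℝ E]
    (T : E →ₗ[ℝ] E) : Prop :=
  ∀ v : E, v ≠ 0 → 0 < ⟪T v, v⟫_ℝ

/-- An abstract model of the exterior powers `Λ²V` (the type `E2`) and `Λ⁴V`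
(the type `E4`) of a real inner product space `V`:
* `wedge2 X Y` models `X ∧ Y ∈ Λ²V` and `wedge4 X Y Z W` models
  `X ∧ Y ∧ Z ∧ W ∈ Λ⁴V`; both are alternating, and their images span.
* The inner products are the induced ones, given by Gram determinants.
* `wedge22` models the wedge product `Λ²V × Λ²V → Λ⁴V`.
* `toOp ω` is the self-adjoint operator on `Λ²V` associated to `ω ∈ Λ⁴V`,
  determined by `⟪toOp ω (X ∧ Y), Z ∧ W⟫ = ω(X,Y,Z,W) = ⟪ω, X ∧ Y ∧ Z ∧ W⟫`
  (using the identification of `Λ⁴V` with 4-forms via the inner product). -/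
structure ExtModel (V E2 E4 : Type*)
    [NormedAddCommGroup V] [InnerProductSpace ℝ V]
    [NormedAddCommGroup E2] [InnerProductSpace ℝ E2]
    [NormedAddCommGroup E4] [InnerProductSpace ℝ E4] where
  wedge2 : V →ₗ[ℝ] V →ₗ[ℝ] E2
  wedge4 : V →ₗ[ℝ] V →ₗ[ℝ] V →ₗ[ℝ] V →ₗ[ℝ] E4
  wedge22 : E2 →ₗ[ℝ] E2 →ₗ[ℝ] E4
  toOp : E4 →ₗ[ℝ] E2 →ₗ[ℝ] E2
  wedge2_self : ∀ X : V, wedge2 X X = 0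
  wedge4_self₁₂ : ∀ X Z W : V, wedge4 X X Z W = 0
  wedge4_self₂₃ : ∀ X Y W : V, wedge4 X Y Y W = 0
  wedge4_self₃₄ : ∀ X Y Z : V, wedge4 X Y Z Z = 0
  span_wedge2 : Submodule.span ℝ {σ : E2 | ∃ X Y : V, σ = wedge2 X Y} = ⊤
  span_wedge4 : Submodule.span ℝ {ω : E4 | ∃ X Y Z W : V, ω = wedge4 X Y Z W} = ⊤
  inner_wedge2 : ∀ X Y Z W : V,
    ⟪wedge2 X Y, wedge2 Z W⟫_ℝ = ⟪X, Z⟫_ℝ * ⟪Y, W⟫_ℝ - ⟪X, W⟫_ℝ * ⟪Y, Z⟫_ℝ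
  inner_wedge4 : ∀ x y : Fin 4 → V,
    ⟪wedge4 (x 0) (x 1) (x 2) (x 3), wedge4 (y 0) (y 1) (y 2) (y 3)⟫_ℝ
      = Matrix.det (Matrix.of fun i j : Fin 4 => ⟪x i, y j⟫_ℝ)
  wedge22_spec : ∀ X Y Z W : V, wedge22 (wedge2 X Y) (wedge2 Z W) = wedge4 X Y Z W
  toOp_spec : ∀ (ω : E4) (X Y Z W : V),
    ⟪toOp ω (wedge2 X Y), wedge2 Z W⟫_ℝ = ⟪ω, wedge4 X Y Z W⟫_ℝ

namespace ExtModel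

variable {V E2 E4 : Type*} [NormedAddCommGroup V] [InnerProductSpace ℝ V]
  [NormedAddCommGroup E2] [InnerProductSpace ℝ E2]
  [NormedAddCommGroup E4] [InnerProductSpace ℝ E4]

/-- The Bianchi map: the 4-linear form associated to an operator
`R : Λ²V → Λ²V` by `b(R)(X,Y,Z,W) = (1/3)(⟪R(X∧Y), Z∧W⟫ + ⟪R(Y∧Z), X∧W⟫ +
⟪R(Z∧X), Y∧W⟫)`. -/
def bianchi (M : ExtModel V E2 E4) (R : E2 →ₗ[ℝ] E2) (X Y Z W : V) : ℝ :=
  (1 / 3) * (⟪R (M.wedge2 X Y), M.wedge2 Z W⟫_ℝ + ⟪R (M.wedge2 Y Z), M.wedge2 X W⟫_ℝ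
    + ⟪R (M.wedge2 Z X), M.wedge2 Y W⟫_ℝ)

end ExtModel

section Semidefinite

variable {E : Type*} [NormedAddCommGroup E] [InnerProductSpace ℝ E]

/-- Let `Q`, `P` be the quadratic forms of `R`, `S`. If `Q ≥ 0` on the null cone of `P`, then the
ratio `-Q / P` on `{P > 0}` is at most the ratio `-Q / P` on `{P < 0}`, stated without division. -/
theorem inner_pencil_nonneg (R S : E →ₗ[ℝ] E)
    (h : ∀ v : E, ⟪S v, v⟫_ℝ = 0 → 0 ≤ ⟪R v, v⟫_ℝ)
    {v w : E} (hv : 0 < ⟪S v, v⟫_ℝ) (hw : ⟪S w, w⟫_ℝ < 0) :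
    0 ≤ ⟪R v, v⟫_ℝ * -⟪S w, w⟫_ℝ + ⟪R w, w⟫_ℝ * ⟪S v, v⟫_ℝ := by
  have expand : ∀ (T : E →ₗ[ℝ] E) (α β : ℝ), ⟪T (α • v + β • w), α • v + β • w⟫_ℝ
      = α ^ 2 * ⟪T v, v⟫_ℝ + α * β * (⟪T v, w⟫_ℝ + ⟪T w, v⟫_ℝ) + β ^ 2 * ⟪T w, w⟫_ℝ := by
    intro T α β
    simp only [map_add, map_smul, inner_add_left, inner_add_right, real_inner_smul_left,
      real_inner_smul_right]
    ring
  have hR := expand R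
  have hS := expand S
  generalize ⟪S v, w⟫_ℝ + ⟪S w, v⟫_ℝ = b at hS
  generalize ⟪R v, w⟫_ℝ + ⟪R w, v⟫_ℝ = k at hR
  generalize ⟪S v, v⟫_ℝ = p at *
  generalize ⟪S w, w⟫_ℝ = c at *
  generalize ⟪R v, v⟫_ℝ = q at *
  generalize ⟪R w, w⟫_ℝ = m at *
  have hcp : c * p < 0 := mul_neg_of_neg_of_pos hw hv
  obtain ⟨r, hr, hr2⟩ : ∃ r : ℝ, 0 ≤ r ∧ r ^ 2 = b ^ 2 - 4 * (c * p) :=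
    ⟨√(b ^ 2 - 4 * (c * p)), Real.sqrt_nonneg _, Real.sq_sqrt (by nlinarith [sq_nonneg b])⟩
  obtain ⟨hb1, hb2⟩ := abs_lt.mp (abs_lt_of_sq_lt_sq (a := b) (b := r) (by linarith) hr)
  have h1 : 0 ≤ (2 * c) ^ 2 * q + 2 * c * (-b + r) * k + (-b + r) ^ 2 * m := by
    rw [← hR]
    refine h _ ?_
    rw [hS]
    linear_combination c * hr2
  have h2 : 0 ≤ (2 * c) ^ 2 * q + 2 * c * (-b - r) * k + (-b - r) ^ 2 * m := by
    rw [← hR]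
    refine h _ ?_
    rw [hS]
    linear_combination c * hr2
  have h3 := add_nonneg (mul_nonneg (by linarith : 0 ≤ b + r) h1)
    (mul_nonneg (by linarith : 0 ≤ -b + r) h2)
  have h4 : 0 ≤ (2 * r * (-4 * c)) * (q * -c + m * p) := by
    refine h3.trans_eq ?_
    linear_combination 2 * r * m * hr2
  exact nonneg_of_mul_nonneg_right h4 (mul_pos (by linarith) (by linarith))

/-- Finsler's lemma: a quadratic form that is nonnegative on the null cone of an indefinite
quadratic form becomes positive-semidefinite after adding a multiple of the latter. -/
theorem exists_add_smul_isPosSemidef (R S : E →ₗ[ℝ] E)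
    (h : ∀ v : E, ⟪S v, v⟫_ℝ = 0 → 0 ≤ ⟪R v, v⟫_ℝ)
    (hpos : ∃ v, 0 < ⟪S v, v⟫_ℝ) (hneg : ∃ w, ⟪S w, w⟫_ℝ < 0) :
    ∃ t : ℝ, IsPosSemidef (R + t • S) := by
  obtain ⟨v₀, hv₀⟩ := hpos
  obtain ⟨w₀, hw₀⟩ := hneg
  let A : Set ℝ := {x | ∃ v, 0 < ⟪S v, v⟫_ℝ ∧ x = -⟪R v, v⟫_ℝ / ⟪S v, v⟫_ℝ}
  have hA : ∀ w, ⟪S w, w⟫_ℝ < 0 → ∀ x ∈ A, x ≤ ⟪R w, w⟫_ℝ / -⟪S w, w⟫_ℝ := by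
    rintro w hw x ⟨v, hv, rfl⟩
    rw [div_le_div_iff₀ hv (by linarith)]
    linarith [inner_pencil_nonneg R S h hv hw]
  refine ⟨sSup A, fun v => ?_⟩
  simp only [LinearMap.add_apply, LinearMap.smul_apply, inner_add_left, real_inner_smul_left]
  rcases lt_trichotomy ⟪S v, v⟫_ℝ 0 with hv | hv | hv
  · have hne : A.Nonempty := ⟨_, v₀, hv₀, rfl⟩
    have := csSup_le hne (hA v hv)
    rw [le_div_iff₀ (by linarith)] at this
    linarith
  · simpa [hv] using h v hv
  · have hbdd : BddAbove A := ⟨_, hA w₀ hw₀⟩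
    have := le_csSup hbdd ⟨v, hv, rfl⟩
    rw [div_le_iff₀ hv] at this
    linarith

theorem IsPosSemidef.apply_eq_zero {T : E →ₗ[ℝ] E} (hT : IsPosSemidef T) (hsym : T.IsSymmetric)
    {x : E} (hx : ⟪T x, x⟫_ℝ = 0) : T x = 0 := by
  have key : ∀ s : ℝ, 0 ≤ 2 * s * ⟪T x, T x⟫_ℝ + s ^ 2 * ⟪T (T x), T x⟫_ℝ := by
    intro s
    have hs := hT (x + s • T x)
    simp only [map_add, map_smul, inner_add_left, inner_add_right, real_inner_smul_left,
      real_inner_smul_right, hx, hsym (T x) x] at hs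
    linarith
  have hc := hT (T x)
  rw [← inner_self_eq_zero (𝕜 := ℝ)]
  generalize ⟪T (T x), T x⟫_ℝ = c at *
  generalize ⟪T x, T x⟫_ℝ = b at *
  have h1 := key (-b / (c + 1))
  have h2 : 2 * (-b / (c + 1)) * b + (-b / (c + 1)) ^ 2 * c
      = -(b ^ 2 * (c + 2)) / (c + 1) ^ 2 := by
    field_simp
    ring
  rw [h2, le_div_iff₀ (by positivity), zero_mul] at h1
  have : b ^ 2 * (c + 2) = 0 := le_antisymm (by linarith) (by positivity)
  simpa [(by positivity : c + 2 ≠ 0)] using this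

end Semidefinite

namespace ExtModel

variable {V E2 E4 : Type*} [NormedAddCommGroup V] [InnerProductSpace ℝ V]
  [NormedAddCommGroup E2] [InnerProductSpace ℝ E2]
  [NormedAddCommGroup E4] [InnerProductSpace ℝ E4] (M : ExtModel V E2 E4)

theorem wedge2_swap (X Y : V) : M.wedge2 Y X = -M.wedge2 X Y := by
  have h := M.wedge2_self (X + Y)
  simp only [map_add, LinearMap.add_apply, M.wedge2_self, zero_add, add_zero] at h
  exact eq_neg_of_add_eq_zero_left h

theorem wedge4_swap₁₂ (X Y Z W : V) : M.wedge4 Y X Z W = -M.wedge4 X Y Z W := by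
  have h := M.wedge4_self₁₂ (X + Y) Z W
  simp only [map_add, LinearMap.add_apply, M.wedge4_self₁₂, zero_add, add_zero] at h
  exact eq_neg_of_add_eq_zero_left h

theorem wedge4_swap₂₃ (X Y Z W : V) : M.wedge4 X Z Y W = -M.wedge4 X Y Z W := by
  have h := M.wedge4_self₂₃ X (Y + Z) W
  simp only [map_add, LinearMap.add_apply, M.wedge4_self₂₃, zero_add, add_zero] at h
  exact eq_neg_of_add_eq_zero_left h

theorem wedge4_swap₃₄ (X Y Z W : V) : M.wedge4 X Y W Z = -M.wedge4 X Y Z W := by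
  have h := M.wedge4_self₃₄ X Y (Z + W)
  simp only [map_add, LinearMap.add_apply, M.wedge4_self₃₄, zero_add, add_zero] at h
  exact eq_neg_of_add_eq_zero_left h

/-- The bivector with coordinates `a` (in the order 01, 02, 03, 12, 13, 23) with respect to the
vectors `e`. -/
def bivector (e : Fin 4 → V) (a : Fin 6 → ℝ) : E2 :=
  a 0 • M.wedge2 (e 0) (e 1) + a 1 • M.wedge2 (e 0) (e 2) + a 2 • M.wedge2 (e 0) (e 3)
    + a 3 • M.wedge2 (e 1) (e 2) + a 4 • M.wedge2 (e 1) (e 3) + a 5 • M.wedge2 (e 2) (e 3)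

theorem exists_eq_bivector (e : Module.Basis (Fin 4) ℝ V) (v : E2) :
    ∃ a, v = M.bivector e a := by
  have hv : v ∈ Submodule.span ℝ {σ : E2 | ∃ X Y : V, σ = M.wedge2 X Y} := by
    rw [M.span_wedge2]; trivial
  induction hv using Submodule.span_induction with
  | mem v h =>
    obtain ⟨X, Y, rfl⟩ := h
    have hX := e.sum_repr X
    have hY := e.sum_repr Y
    generalize e.repr X = x at hX
    generalize e.repr Y = y at hY
    refine ⟨![x 0 * y 1 - x 1 * y 0, x 0 * y 2 - x 2 * y 0, x 0 * y 3 - x 3 * y 0,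
      x 1 * y 2 - x 2 * y 1, x 1 * y 3 - x 3 * y 1, x 2 * y 3 - x 3 * y 2], ?_⟩
    rw [← hX, ← hY]
    simp only [Fin.sum_univ_four, map_add, map_smul, LinearMap.add_apply, LinearMap.smul_apply,
      M.wedge2_self, M.wedge2_swap (e 0) (e 1), M.wedge2_swap (e 0) (e 2),
      M.wedge2_swap (e 0) (e 3), M.wedge2_swap (e 1) (e 2), M.wedge2_swap (e 1) (e 3),
      M.wedge2_swap (e 2) (e 3), bivector]
    simp
    module
  | zero => exact ⟨0, by simp [bivector]⟩
  | add v w _ _ hv hw =>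
    obtain ⟨a, rfl⟩ := hv
    obtain ⟨b, rfl⟩ := hw
    exact ⟨a + b, by simp only [bivector, Pi.add_apply]; module⟩
  | smul t v _ hv =>
    obtain ⟨a, rfl⟩ := hv
    exact ⟨t • a, by simp only [bivector, Pi.smul_apply, smul_eq_mul]; module⟩

theorem inner_toOp_bivector (e : Fin 4 → V) (ω : E4) (a b : Fin 6 → ℝ) :
    ⟪M.toOp ω (M.bivector e a), M.bivector e b⟫_ℝ
      = ⟪ω, M.wedge4 (e 0) (e 1) (e 2) (e 3)⟫_ℝ
        * (a 0 * b 5 - a 1 * b 4 + a 2 * b 3 + a 3 * b 2 - a 4 * b 1 + a 5 * b 0) := by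
  simp only [bivector, map_add, map_smul, inner_add_left, inner_add_right, real_inner_smul_left,
    real_inner_smul_right, M.toOp_spec, M.wedge4_self₁₂, M.wedge4_self₂₃, M.wedge4_self₃₄,
    M.wedge4_swap₁₂ (e 0) (e 1), M.wedge4_swap₁₂ (e 0) (e 2), M.wedge4_swap₁₂ (e 1) (e 2),
    M.wedge4_swap₂₃ _ (e 0) (e 1), M.wedge4_swap₂₃ _ (e 0) (e 2), M.wedge4_swap₂₃ _ (e 0) (e 3),
    M.wedge4_swap₂₃ _ (e 1) (e 2), M.wedge4_swap₂₃ _ (e 1) (e 3), M.wedge4_swap₂₃ _ (e 2) (e 3),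
    M.wedge4_swap₃₄ _ _ (e 1) (e 2), M.wedge4_swap₃₄ _ _ (e 1) (e 3),
    M.wedge4_swap₃₄ _ _ (e 2) (e 3), inner_neg_right, inner_zero_right, neg_zero]
  ring

/-- A bivector satisfying the Plücker relation whose first coordinate is nonzero is
decomposable. -/
theorem bivector_decomposable_of_ne_zero (e : Fin 4 → V) (a : Fin 6 → ℝ) (h0 : a 0 ≠ 0)
    (h : a 0 * a 5 - a 1 * a 4 + a 2 * a 3 = 0) :
    ∃ X Y, M.bivector e a = M.wedge2 X Y := by
  refine ⟨e 0 - (a 3 / a 0) • e 2 - (a 4 / a 0) • e 3, a 0 • e 1 + a 1 • e 2 + a 2 • e 3, ?_⟩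
  have h5 : a 5 = (a 1 * a 4 - a 2 * a 3) / a 0 := by
    field_simp
    linarith
  simp only [bivector, map_add, map_sub, map_smul, LinearMap.sub_apply, LinearMap.smul_apply,
    M.wedge2_self, M.wedge2_swap (e 1) (e 2), M.wedge2_swap (e 1) (e 3),
    M.wedge2_swap (e 2) (e 3), h5]
  match_scalars <;> field_simp
  ring

theorem bivector_decomposable (e : Fin 4 → V) (a : Fin 6 → ℝ)
    (h : a 0 * a 5 - a 1 * a 4 + a 2 * a 3 = 0) :
    ∃ X Y, M.bivector e a = M.wedge2 X Y := by
  have reindex : ∀ (f : Fin 4 → V) (b : Fin 6 → ℝ), b 0 ≠ 0 →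
      b 0 * b 5 - b 1 * b 4 + b 2 * b 3 = 0 → M.bivector e a = M.bivector f b →
      ∃ X Y, M.bivector e a = M.wedge2 X Y := fun f b h0 hb hab =>
    hab ▸ M.bivector_decomposable_of_ne_zero f b h0 hb
  by_cases h0 : a 0 ≠ 0
  · exact M.bivector_decomposable_of_ne_zero e a h0 h
  by_cases h1 : a 1 ≠ 0
  · refine reindex ![e 0, e 2, e 1, e 3] ![a 1, a 0, a 2, -a 3, a 5, a 4] h1 ?_ ?_
    · simp; linarith
    · simp [bivector, M.wedge2_swap (e 1) (e 2)]; module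
  by_cases h2 : a 2 ≠ 0
  · refine reindex ![e 0, e 3, e 1, e 2] ![a 2, a 0, a 1, -a 4, -a 5, a 3] h2 ?_ ?_
    · simp; linarith
    · simp [bivector, M.wedge2_swap (e 1) (e 3), M.wedge2_swap (e 2) (e 3)]; module
  by_cases h3 : a 3 ≠ 0
  · refine reindex ![e 1, e 2, e 0, e 3] ![a 3, -a 0, a 4, -a 1, a 5, a 2] h3 ?_ ?_
    · simp; linarith
    · simp [bivector, M.wedge2_swap (e 0) (e 1), M.wedge2_swap (e 0) (e 2)]; module
  by_cases h4 : a 4 ≠ 0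
  · refine reindex ![e 1, e 3, e 0, e 2] ![a 4, -a 0, a 3, -a 2, -a 5, a 1] h4 ?_ ?_
    · simp; linarith
    · simp [bivector, M.wedge2_swap (e 0) (e 1), M.wedge2_swap (e 0) (e 3),
        M.wedge2_swap (e 2) (e 3)]; module
  · push Not at h0 h1 h2 h3 h4
    exact ⟨a 5 • e 2, e 3, by simp [bivector, h0, h1, h2, h3, h4]⟩

/-- In dimension four, the operator of a 4-vector kills a nonzero bivector only if the 4-vector
is zero. -/
theorem eq_zero_of_toOp_apply_eq_zero (e : Module.Basis (Fin 4) ℝ V) {ω : E4} {σ : E2}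
    (hσ : σ ≠ 0) (h : M.toOp ω σ = 0) : ω = 0 := by
  have hΩ : ⟪ω, M.wedge4 (e 0) (e 1) (e 2) (e 3)⟫_ℝ = 0 := by
    by_contra hne
    obtain ⟨a, rfl⟩ := M.exists_eq_bivector e σ
    have key := fun b => M.inner_toOp_bivector e ω a b
    simp only [h, inner_zero_left, zero_eq_mul, hne, false_or] at key
    have k0 := key ![1, 0, 0, 0, 0, 0]
    have k1 := key ![0, 1, 0, 0, 0, 0]
    have k2 := key ![0, 0, 1, 0, 0, 0]
    have k3 := key ![0, 0, 0, 1, 0, 0]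
    have k4 := key ![0, 0, 0, 0, 1, 0]
    have k5 := key ![0, 0, 0, 0, 0, 1]
    simp at k0 k1 k2 k3 k4 k5
    exact hσ (by simp [bivector, k0, k1, k2, k3, k4, k5])
  have hω : ω ∈ (Submodule.span ℝ {ω : E4 | ∃ X Y Z W : V, ω = M.wedge4 X Y Z W})ᗮ := by
    rw [Submodule.mem_orthogonal']
    intro τ hτ
    induction hτ using Submodule.span_induction with
    | mem τ h =>
      obtain ⟨X, Y, Z, W, rfl⟩ := h
      obtain ⟨a, ha⟩ := M.exists_eq_bivector e (M.wedge2 X Y)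
      obtain ⟨b, hb⟩ := M.exists_eq_bivector e (M.wedge2 Z W)
      rw [← M.toOp_spec, ha, hb, M.inner_toOp_bivector, hΩ, zero_mul]
    | zero => exact inner_zero_right _
    | add _ _ _ _ h₁ h₂ => rw [inner_add_right, h₁, h₂, add_zero]
    | smul _ _ _ h => rw [real_inner_smul_right, h, mul_zero]
  rwa [M.span_wedge4, Submodule.top_orthogonal_eq_bot, Submodule.mem_bot] at hω

theorem toOp_isSymmetric (e : Module.Basis (Fin 4) ℝ V) (ω : E4) :
    (M.toOp ω).IsSymmetric := by
  intro v w
  obtain ⟨a, rfl⟩ := M.exists_eq_bivector e v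
  obtain ⟨b, rfl⟩ := M.exists_eq_bivector e w
  rw [real_inner_comm (M.toOp ω _), M.inner_toOp_bivector, M.inner_toOp_bivector]
  ring

theorem inner_toOp_wedge2_self (ω : E4) (X Y : V) :
    ⟪M.toOp ω (M.wedge2 X Y), M.wedge2 X Y⟫_ℝ = 0 := by
  rw [M.toOp_spec, M.wedge4_swap₂₃, M.wedge4_self₁₂, neg_zero, inner_zero_right]

/-- Existence of a semidefinite modification: the operator of the volume element is indefinite
and its null cone consists of decomposable bivectors, so Finsler's lemma applies. -/
theorem exists_isPosSemidef_add_toOp (e : OrthonormalBasis (Fin 4) ℝ V) (R : E2 →ₗ[ℝ] E2)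
    (hsec : ∀ X Y : V, 0 ≤ ⟪R (M.wedge2 X Y), M.wedge2 X Y⟫_ℝ) :
    ∃ ω : E4, IsPosSemidef (R + M.toOp ω) := by
  have hΩ : ⟪M.wedge4 (e 0) (e 1) (e 2) (e 3), M.wedge4 (e 0) (e 1) (e 2) (e 3)⟫_ℝ = 1 := by
    rw [M.inner_wedge4 e e]
    convert Matrix.det_one (n := Fin 4) (R := ℝ)
    ext i j
    rw [Matrix.of_apply, orthonormal_iff_ite.mp e.orthonormal, Matrix.one_apply]
  have hB := M.inner_toOp_bivector e (M.wedge4 (e 0) (e 1) (e 2) (e 3))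
  simp only [hΩ, one_mul] at hB
  have hcone : ∀ v, ⟪M.toOp (M.wedge4 (e 0) (e 1) (e 2) (e 3)) v, v⟫_ℝ = 0 → 0 ≤ ⟪R v, v⟫_ℝ := by
    intro v hv
    obtain ⟨a, rfl⟩ := M.exists_eq_bivector e.toBasis v
    rw [OrthonormalBasis.coe_toBasis] at hv ⊢
    rw [hB] at hv
    obtain ⟨X, Y, hXY⟩ := M.bivector_decomposable e a (by linarith)
    rw [hXY]
    exact hsec X Y
  obtain ⟨t, ht⟩ := exists_add_smul_isPosSemidef R
    (M.toOp (M.wedge4 (e 0) (e 1) (e 2) (e 3))) hcone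
    ⟨M.bivector e ![1, 0, 0, 0, 0, 1], by rw [hB]; simp⟩
    ⟨M.bivector e ![1, 0, 0, 0, 0, -1], by rw [hB]; simp⟩
  exact ⟨t • M.wedge4 (e 0) (e 1) (e 2) (e 3), by rwa [map_smul]⟩

end ExtModel

/-- Uniqueness of the semidefinite modification in dimension
4. Let `dim V = 4` and let `R` be an algebraic curvature operator on `Λ²V`
with `sec_R ≥ 0` on all decomposables and `sec_R(σ₀) = 0` for some nonzero
decomposable `σ₀`. Then there exists a unique `ω ∈ Λ⁴V` such that `R + ω` is
positive-semidefinite. -/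
theorem dim_four_unique_semidefinite_modification
    {V E2 E4 : Type*}
    [NormedAddCommGroup V] [InnerProductSpace ℝ V] [FiniteDimensional ℝ V]
    [NormedAddCommGroup E2] [InnerProductSpace ℝ E2] [FiniteDimensional ℝ E2]
    [NormedAddCommGroup E4] [InnerProductSpace ℝ E4] [FiniteDimensional ℝ E4]
    (hdim : Module.finrank ℝ V = 4)
    (M : ExtModel V E2 E4)
    (R : E2 →ₗ[ℝ] E2) (hR_sym : R.IsSymmetric)
    (hR_bianchi : ∀ X Y Z W : V, M.bianchi R X Y Z W = 0)
    (hsec_nonneg : ∀ X Y : V, 0 ≤ ⟪R (M.wedge2 X Y), M.wedge2 X Y⟫_ℝ)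
    (hsec_zero : ∃ X Y : V, M.wedge2 X Y ≠ 0 ∧ ⟪R (M.wedge2 X Y), M.wedge2 X Y⟫_ℝ = 0) :
    ∃! ω : E4, IsPosSemidef (R + M.toOp ω) := by
  obtain ⟨X, Y, hne, hzero⟩ := hsec_zero
  let e := stdOrthonormalBasis ℝ V |>.reindex (finCongr hdim)
  obtain ⟨ω, hω⟩ := M.exists_isPosSemidef_add_toOp e R hsec_nonneg
  have kernel : ∀ τ : E4, IsPosSemidef (R + M.toOp τ) → (R + M.toOp τ) (M.wedge2 X Y) = 0 :=
    fun τ hτ => hτ.apply_eq_zero (hR_sym.add (M.toOp_isSymmetric e.toBasis τ)) (by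
      rw [LinearMap.add_apply, inner_add_left, hzero, M.inner_toOp_wedge2_self, add_zero])
  refine ⟨ω, hω, fun τ hτ => sub_eq_zero.mp ?_⟩
  refine M.eq_zero_of_toOp_apply_eq_zero e.toBasis hne ?_
  have h := (kernel τ hτ).trans (kernel ω hω).symm
  rw [LinearMap.add_apply, LinearMap.add_apply, add_right_inj] at h
  rw [map_sub, LinearMap.sub_apply, h, sub_self]
end
end

section
/- Let V be a real inner product space of dimension 4n (n ≥ 1) with three orthogonal complex structures I, J, K satisfying K = IJ = −JI, and let ω_A ∈ Λ²V denote ω_A(X,Y) = ⟨AX, Y⟩ for A ∈ {I, J, K}. Define the self-adjoint operator R on Λ²V (the curvature operator of ℍPⁿ) by ⟨R(X∧Y), Z∧W⟩ = ⟨X,Z⟩⟨Y,W⟩ − ⟨X,W⟩⟨Y,Z⟩ + Σ_{A∈{I,J,K}} (⟨AX,Z⟩⟨AY,W⟩ − ⟨AX,W⟩⟨AY,Z⟩ + 2⟨AX,Y⟩⟨AZ,W⟩). Then there exists c > 0 such that R + c·(ω_I∧ω_I + ω_J∧ω_J + ω_K∧ω_K) is positive-definite; in particular, R has strongly positive curvature.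 -/
/- Common setup: an abstract model of the second and fourth exterior powers
`Λ²V` and `Λ⁴V` of a real inner product space `V`, with the induced inner
products, the identification of 4-vectors with self-adjoint operators on
`Λ²V`, and the Bianchi map. -/

noncomputable section

open scoped InnerProductSpace

namespace ExtModel

variable {V E2 E4 : Type*} [NormedAddCommGroup V] [InnerProductSpace ℝ V]
  [NormedAddCommGroup E2] [InnerProductSpace ℝ E2]
  [NormedAddCommGroup E4] [InnerProductSpace ℝ E4]

/-- To prove an additive and homogeneous property of 2-vectors, it suffices to check it on
decomposable ones. -/
theorem induction_wedge2 (M : ExtModel V E2 E4) {p : E2 → Prop}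
    (wedge : ∀ X Y : V, p (M.wedge2 X Y))
    (add : ∀ σ τ : E2, p σ → p τ → p (σ + τ))
    (smul : ∀ (a : ℝ) (σ : E2), p σ → p (a • σ)) (σ : E2) : p σ := by
  have hσ : σ ∈ Submodule.span ℝ {σ : E2 | ∃ X Y : V, σ = M.wedge2 X Y} := by
    rw [M.span_wedge2]
    trivial
  induction hσ using Submodule.span_induction with
  | mem τ hτ =>
    obtain ⟨X, Y, rfl⟩ := hτ
    exact wedge X Y
  | zero => simpa using wedge 0 0
  | add σ τ _ _ hσ hτ => exact add σ τ hσ hτ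
  | smul a σ _ hσ => exact smul a σ hσ

/-- The wedge product of two 2-vectors, evaluated as a 4-form. -/
theorem inner_wedge22 (M : ExtModel V E2 E4) (σ τ : E2) (X Y Z W : V) :
    ⟪M.wedge22 σ τ, M.wedge4 X Y Z W⟫_ℝ
      = ⟪σ, M.wedge2 X Y⟫_ℝ * ⟪τ, M.wedge2 Z W⟫_ℝ
        + ⟪σ, M.wedge2 Z W⟫_ℝ * ⟪τ, M.wedge2 X Y⟫_ℝ
        - ⟪σ, M.wedge2 X Z⟫_ℝ * ⟪τ, M.wedge2 Y W⟫_ℝ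
        - ⟪σ, M.wedge2 Y W⟫_ℝ * ⟪τ, M.wedge2 X Z⟫_ℝ
        + ⟪σ, M.wedge2 X W⟫_ℝ * ⟪τ, M.wedge2 Y Z⟫_ℝ
        + ⟪σ, M.wedge2 Y Z⟫_ℝ * ⟪τ, M.wedge2 X W⟫_ℝ := by
  induction σ using M.induction_wedge2 with
  | add σ₁ σ₂ h₁ h₂ =>
    simp only [map_add, LinearMap.add_apply, inner_add_left, h₁, h₂]
    ring
  | smul a σ h =>
    simp only [map_smul, LinearMap.smul_apply, real_inner_smul_left, h]
    ring
  | wedge A B =>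
    induction τ using M.induction_wedge2 with
    | add τ₁ τ₂ h₁ h₂ =>
      simp only [map_add, inner_add_left, h₁, h₂]
      ring
    | smul a τ h =>
      simp only [map_smul, real_inner_smul_left, h]
      ring
    | wedge C D =>
      have h := M.inner_wedge4 ![A, B, C, D] ![X, Y, Z, W]
      simp [Matrix.det_succ_row_zero, Fin.sum_univ_succ, Fin.succAbove] at h
      rw [M.wedge22_spec, h]
      simp only [M.inner_wedge2]
      ring

/-- Two operators on 2-vectors whose bilinear forms agree on decomposable 2-vectors have the same
bilinear form. -/
theorem inner_eq_of_wedge2 (M : ExtModel V E2 E4) {S T : E2 →ₗ[ℝ] E2}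
    (h : ∀ X Y Z W : V, ⟪S (M.wedge2 X Y), M.wedge2 Z W⟫_ℝ
      = ⟪T (M.wedge2 X Y), M.wedge2 Z W⟫_ℝ) (σ τ : E2) :
    ⟪S σ, τ⟫_ℝ = ⟪T σ, τ⟫_ℝ := by
  induction σ using M.induction_wedge2 with
  | add σ₁ σ₂ h₁ h₂ => simp only [map_add, inner_add_left, h₁, h₂]
  | smul a σ h => simp only [map_smul, real_inner_smul_left, h]
  | wedge X Y =>
    induction τ using M.induction_wedge2 with
    | add τ₁ τ₂ h₁ h₂ => simp only [inner_add_right, h₁, h₂]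
    | smul a τ h => simp only [real_inner_smul_right, h]
    | wedge Z W => exact h X Y Z W

end ExtModel

/-- The curvature operator of `ℍPⁿ` has strongly positive
curvature. Let `V` be a real inner product space of dimension `4n` (`n ≥ 1`)
with three orthogonal complex structures `I, J, K` satisfying `K = IJ = −JI`,
let `ωI, ωJ, ωK ∈ Λ²V` be the associated Kähler forms (`ω_A(X,Y) = ⟪A X, Y⟫`,
identified with 2-vectors via the inner product), and let `R` be the
self-adjoint operator on `Λ²V` given by
`⟪R(X∧Y), Z∧W⟫ = ⟪X,Z⟫⟪Y,W⟫ − ⟪X,W⟫⟪Y,Z⟫ +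
Σ_{A ∈ {I,J,K}} (⟪AX,Z⟫⟪AY,W⟫ − ⟪AX,W⟫⟪AY,Z⟫ + 2⟪AX,Y⟫⟪AZ,W⟫)`.
Then there exists `c > 0` such that
`R + c (ωI∧ωI + ωJ∧ωJ + ωK∧ωK)` is positive-definite; in particular `R` has
strongly positive curvature. -/
theorem quaternionic_projective_strongly_positive
    {V E2 E4 : Type*}
    [NormedAddCommGroup V] [InnerProductSpace ℝ V] [FiniteDimensional ℝ V]
    [NormedAddCommGroup E2] [InnerProductSpace ℝ E2] [FiniteDimensional ℝ E2]
    [NormedAddCommGroup E4] [InnerProductSpace ℝ E4] [FiniteDimensional ℝ E4]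
    (n : ℕ) (hn : 1 ≤ n) (hdim : Module.finrank ℝ V = 4 * n)
    (M : ExtModel V E2 E4)
    (I J K : V →ₗ[ℝ] V)
    (hI_sq : ∀ X : V, I (I X) = -X)
    (hJ_sq : ∀ X : V, J (J X) = -X)
    (hK_sq : ∀ X : V, K (K X) = -X)
    (hI_orth : ∀ X Y : V, ⟪I X, I Y⟫_ℝ = ⟪X, Y⟫_ℝ)
    (hJ_orth : ∀ X Y : V, ⟪J X, J Y⟫_ℝ = ⟪X, Y⟫_ℝ)
    (hK_orth : ∀ X Y : V, ⟪K X, K Y⟫_ℝ = ⟪X, Y⟫_ℝ)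
    (hK_IJ : ∀ X : V, K X = I (J X))
    (hIJ_anti : ∀ X : V, I (J X) = - J (I X))
    (ωI ωJ ωK : E2)
    (hωI : ∀ X Y : V, ⟪ωI, M.wedge2 X Y⟫_ℝ = ⟪I X, Y⟫_ℝ)
    (hωJ : ∀ X Y : V, ⟪ωJ, M.wedge2 X Y⟫_ℝ = ⟪J X, Y⟫_ℝ)
    (hωK : ∀ X Y : V, ⟪ωK, M.wedge2 X Y⟫_ℝ = ⟪K X, Y⟫_ℝ)
    (R : E2 →ₗ[ℝ] E2) (hR_sym : R.IsSymmetric)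
    (hR : ∀ X Y Z W : V,
      ⟪R (M.wedge2 X Y), M.wedge2 Z W⟫_ℝ
        = ⟪X, Z⟫_ℝ * ⟪Y, W⟫_ℝ - ⟪X, W⟫_ℝ * ⟪Y, Z⟫_ℝ
          + (⟪I X, Z⟫_ℝ * ⟪I Y, W⟫_ℝ - ⟪I X, W⟫_ℝ * ⟪I Y, Z⟫_ℝ
            + 2 * ⟪I X, Y⟫_ℝ * ⟪I Z, W⟫_ℝ)
          + (⟪J X, Z⟫_ℝ * ⟪J Y, W⟫_ℝ - ⟪J X, W⟫_ℝ * ⟪J Y, Z⟫_ℝ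
            + 2 * ⟪J X, Y⟫_ℝ * ⟪J Z, W⟫_ℝ)
          + (⟪K X, Z⟫_ℝ * ⟪K Y, W⟫_ℝ - ⟪K X, W⟫_ℝ * ⟪K Y, Z⟫_ℝ
            + 2 * ⟪K X, Y⟫_ℝ * ⟪K Z, W⟫_ℝ)) :
    (∃ c : ℝ, 0 < c ∧ IsPosDef (R + M.toOp
      (c • (M.wedge22 ωI ωI + M.wedge22 ωJ ωJ + M.wedge22 ωK ωK)))) ∧
    (∃ ω : E4, IsPosDef (R + M.toOp ω)) := by
  have hpos : IsPosDef (R + M.toOp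
      ((1 / 2 : ℝ) • (M.wedge22 ωI ωI + M.wedge22 ωJ ωJ + M.wedge22 ωK ωK))) := by
    intro v hv
    let rankOne (ω : E2) : E2 →ₗ[ℝ] E2 := (innerₛₗ ℝ ω).smulRight ω
    have hform := M.inner_eq_of_wedge2
      (S := R + M.toOp
        ((1 / 2 : ℝ) • (M.wedge22 ωI ωI + M.wedge22 ωJ ωJ + M.wedge22 ωK ωK)))
      (T := LinearMap.id + (3 : ℝ) • (rankOne ωI + rankOne ωJ + rankOne ωK))
      (by
        intro X Y Z W
        simp only [rankOne, LinearMap.add_apply, LinearMap.smul_apply, LinearMap.id_apply,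
          LinearMap.smulRight_apply, innerₛₗ_apply_apply, inner_add_left, real_inner_smul_left,
          hR, M.toOp_spec, M.inner_wedge22, M.inner_wedge2, hωI, hωJ, hωK]
        ring) v v
    rw [hform]
    simp only [rankOne, LinearMap.add_apply, LinearMap.smul_apply, LinearMap.id_apply,
      LinearMap.smulRight_apply, innerₛₗ_apply_apply, inner_add_left, real_inner_smul_left]
    have hv' : 0 < ⟪v, v⟫_ℝ := real_inner_self_pos.mpr hv
    nlinarith [mul_self_nonneg ⟪ωI, v⟫_ℝ, mul_self_nonneg ⟪ωJ, v⟫_ℝ,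
      mul_self_nonneg ⟪ωK, v⟫_ℝ]
  exact ⟨⟨1 / 2, by norm_num, hpos⟩, ⟨_, hpos⟩⟩
end
end
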